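/- arXiv:1509.00777 — 3 statements merged into one kernel-verified Lean document; each statement's English description precedes it below -/
import Mathlib

section
/- Let K be an n×n complex positive semidefinite matrix. Then the function f(X) = log det(I + K X⁻¹) is convex on the cone of n×n complex positive definite matrices; that is, for all positive definite X, Y and all λ ∈ [0,1], one has f(λX + (1−λ)Y) ≤ λ f(X) + (1−λ) f(Y). -/
open Matrix
open scoped ComplexOrder

namespace Matrix

variable {ι : Type*}

/-- A convex combination of positive definite complex matrices is positive definite. -/
theorem PosDef.smul_add_smul {X Y : Matrix ι ι ℂ} (hX : X.PosDef) (hY : Y.PosDef)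
    {a b : ℝ} (ha : 0 ≤ a) (hb : 0 ≤ b) (hab : a + b = 1) :
    ((a : ℂ) • X + (b : ℂ) • Y).PosDef := by
  rcases ha.eq_or_lt with rfl | ha
  · obtain rfl : b = 1 := by linarith
    simpa using hY
  · exact (hX.smul (by exact_mod_cast ha)).add_posSemidef
      (hY.posSemidef.smul (by exact_mod_cast hb))

theorem smul_add_smul_add (X Y K : Matrix ι ι ℂ) {a b : ℝ} (hab : a + b = 1) :
    (a : ℂ) • X + (b : ℂ) • Y + K = (a : ℂ) • (X + K) + (b : ℂ) • (Y + K) := by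
  have h : (a : ℂ) + b = 1 := by exact_mod_cast hab
  rw [smul_add, smul_add, add_add_add_comm, ← add_smul, h, one_smul]

variable [Fintype ι]

theorem re_star_dotProduct_comm (u v : ι → ℂ) : (star u ⬝ᵥ v).re = (star v ⬝ᵥ u).re := by
  rw [← Complex.conj_re, starRingEnd_apply, ← star_dotProduct]

variable [DecidableEq ι]

theorem PosDef.det_re_pos {A : Matrix ι ι ℂ} (hA : A.PosDef) : 0 < A.det.re :=
  (Complex.pos_iff.mp hA.det_pos).1

/-- A lower bound for the quadratic form of the inverse, with equality at `u = A⁻¹ v`. -/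
theorem PosDef.le_re_dotProduct_inv_mulVec {A : Matrix ι ι ℂ} (hA : A.PosDef) (u v : ι → ℂ) :
    2 * (star v ⬝ᵥ u).re - (star u ⬝ᵥ A *ᵥ u).re ≤ (star v ⬝ᵥ A⁻¹ *ᵥ v).re := by
  set w := A⁻¹ *ᵥ v with hw
  have hAw : A *ᵥ w = v := by
    rw [hw, mulVec_mulVec, mul_nonsing_inv _ ((isUnit_iff_isUnit_det _).mp hA.isUnit), one_mulVec]
  have hwA : star w ⬝ᵥ A *ᵥ u = star v ⬝ᵥ u := by
    rw [dotProduct_mulVec, ← hA.isHermitian.eq, ← star_mulVec, hAw]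
  have hwv := re_star_dotProduct_comm w v
  have huv := re_star_dotProduct_comm u v
  have h := hA.posSemidef.re_dotProduct_nonneg (u - w)
  simp only [star_sub, mulVec_sub, sub_dotProduct, dotProduct_sub, hAw, hwA,
    RCLike.re_to_complex, Complex.sub_re, hwv, huv] at h
  linarith

/-- The quadratic form of the inverse is convex on the positive definite cone. -/
theorem PosDef.re_dotProduct_inv_mulVec_le {X Y : Matrix ι ι ℂ} (hX : X.PosDef) (hY : Y.PosDef)
    {a b : ℝ} (ha : 0 ≤ a) (hb : 0 ≤ b) (hab : a + b = 1) (v : ι → ℂ) :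
    (star v ⬝ᵥ ((a : ℂ) • X + (b : ℂ) • Y)⁻¹ *ᵥ v).re ≤
      a * (star v ⬝ᵥ X⁻¹ *ᵥ v).re + b * (star v ⬝ᵥ Y⁻¹ *ᵥ v).re := by
  have hZ := hX.smul_add_smul hY ha hb hab
  set Z := (a : ℂ) • X + (b : ℂ) • Y with hZdef
  set u := Z⁻¹ *ᵥ v with hu
  have hZu : Z *ᵥ u = v := by
    rw [hu, mulVec_mulVec, mul_nonsing_inv _ ((isUnit_iff_isUnit_det _).mp hZ.isUnit), one_mulVec]
  have huv := re_star_dotProduct_comm u v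
  have hquad : (star v ⬝ᵥ u).re =
      a * (star u ⬝ᵥ X *ᵥ u).re + b * (star u ⬝ᵥ Y *ᵥ u).re := by
    rw [← huv, ← hZu, hZdef]
    simp [add_mulVec, smul_mulVec, dotProduct_add, dotProduct_smul]
  have h₁ := mul_le_mul_of_nonneg_left (hX.le_re_dotProduct_inv_mulVec u v) ha
  have h₂ := mul_le_mul_of_nonneg_left (hY.le_re_dotProduct_inv_mulVec u v) hb
  linear_combination h₁ + h₂ - hquad - 2 * (star v ⬝ᵥ u).re * hab

/-- The matrix determinant lemma for subtracting a rank-one matrix. -/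
theorem PosDef.det_re_eq_mul_one_sub {X : Matrix ι ι ℂ} (hX : X.PosDef) (v : ι → ℂ) :
    X.det.re = (X + vecMulVec v (star v)).det.re *
      (1 - (star v ⬝ᵥ (X + vecMulVec v (star v))⁻¹ *ᵥ v).re) := by
  have hW := hX.add_posSemidef (posSemidef_vecMulVec_self_star v)
  set W := X + vecMulVec v (star v) with hWdef
  have hu := (isUnit_iff_isUnit_det _).mp hW.isUnit
  have hfac : X = W * (1 + vecMulVec (-(W⁻¹ *ᵥ v)) (star v)) := by
    rw [Matrix.mul_add, mul_one, mul_vecMulVec, mulVec_neg, mulVec_mulVec, mul_nonsing_inv _ hu,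
      one_mulVec, neg_vecMulVec, hWdef, add_neg_cancel_right]
  have hdet : X.det = W.det * (1 - star v ⬝ᵥ W⁻¹ *ᵥ v) := by
    conv_lhs => rw [hfac]
    rw [det_mul, vecMulVec_eq Unit, det_one_add_replicateCol_mul_replicateRow, dotProduct_neg,
      sub_eq_add_neg]
  rw [hdet, Complex.mul_re, ← (Complex.pos_iff.mp hW.det_pos).2]
  simp

theorem PosDef.log_det_sub_log_det_add_vecMulVec {X : Matrix ι ι ℂ} (hX : X.PosDef)
    (v : ι → ℂ) :
    0 < 1 - (star v ⬝ᵥ (X + vecMulVec v (star v))⁻¹ *ᵥ v).re ∧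
    Real.log (X + vecMulVec v (star v)).det.re - Real.log X.det.re =
      -Real.log (1 - (star v ⬝ᵥ (X + vecMulVec v (star v))⁻¹ *ᵥ v).re) := by
  have hW := (hX.add_posSemidef (posSemidef_vecMulVec_self_star v)).det_re_pos
  have h := hX.det_re_eq_mul_one_sub v
  have hpos := (pos_iff_pos_of_mul_pos (h ▸ hX.det_re_pos)).mp hW
  refine ⟨hpos, ?_⟩
  rw [h, Real.log_mul hW.ne' hpos.ne']
  ring

theorem PosDef.log_det_add_vecMulVec_sub_le {X Y : Matrix ι ι ℂ} (hX : X.PosDef) (hY : Y.PosDef)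
    {a b : ℝ} (ha : 0 ≤ a) (hb : 0 ≤ b) (hab : a + b = 1) (v : ι → ℂ) :
    Real.log ((a : ℂ) • X + (b : ℂ) • Y + vecMulVec v (star v)).det.re
        - Real.log ((a : ℂ) • X + (b : ℂ) • Y).det.re ≤
      a * (Real.log (X + vecMulVec v (star v)).det.re - Real.log X.det.re)
        + b * (Real.log (Y + vecMulVec v (star v)).det.re - Real.log Y.det.re) := by
  have hK := posSemidef_vecMulVec_self_star v
  obtain ⟨hX', eX⟩ := hX.log_det_sub_log_det_add_vecMulVec v
  obtain ⟨hY', eY⟩ := hY.log_det_sub_log_det_add_vecMulVec v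
  obtain ⟨-, eZ⟩ := (hX.smul_add_smul hY ha hb hab).log_det_sub_log_det_add_vecMulVec v
  rw [eX, eY, eZ, smul_add_smul_add X Y _ hab]
  have hq := (hX.add_posSemidef hK).re_dotProduct_inv_mulVec_le (hY.add_posSemidef hK)
    ha hb hab v
  have hlog := strictConcaveOn_log_Ioi.concaveOn.2 hX' hY' ha hb hab
  have hcomb := (convex_Ioi (0 : ℝ)) hX' hY' ha hb hab
  simp only [smul_eq_mul, Set.mem_Ioi] at hlog hcomb
  have hmono := Real.log_le_log hcomb
    (show _ ≤ 1 - (star v ⬝ᵥ ((a : ℂ) • (X + vecMulVec v (star v))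
      + (b : ℂ) • (Y + vecMulVec v (star v)))⁻¹ *ᵥ v).re by linear_combination hq + hab)
  linarith

/-- `log det (X + K) - log det X` is a convex function of the positive definite matrix `X`. -/
theorem PosDef.log_det_add_sub_le {X Y K : Matrix ι ι ℂ} (hX : X.PosDef) (hY : Y.PosDef)
    (hK : K.PosSemidef) {a b : ℝ} (ha : 0 ≤ a) (hb : 0 ≤ b) (hab : a + b = 1) :
    Real.log ((a : ℂ) • X + (b : ℂ) • Y + K).det.re
        - Real.log ((a : ℂ) • X + (b : ℂ) • Y).det.re ≤
      a * (Real.log (X + K).det.re - Real.log X.det.re)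
        + b * (Real.log (Y + K).det.re - Real.log Y.det.re) := by
  obtain ⟨m, v, rfl⟩ := posSemidef_iff_eq_sum_vecMulVec.mp hK
  clear hK
  induction m generalizing X Y with
  | zero => simp
  | succ m ih =>
    have hv := posSemidef_vecMulVec_self_star (v 0)
    have h₀ := hX.log_det_add_vecMulVec_sub_le hY ha hb hab (v 0)
    have h₁ := ih (hX.add_posSemidef hv) (hY.add_posSemidef hv) (fun i => v i.succ)
    rw [← smul_add_smul_add X Y _ hab] at h₁
    simp only [Fin.sum_univ_succ, ← add_assoc]
    linarith

theorem PosDef.log_det_one_add_mul_inv {X K : Matrix ι ι ℂ} (hX : X.PosDef)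
    (hK : K.PosSemidef) :
    Real.log (1 + K * X⁻¹).det.re = Real.log (X + K).det.re - Real.log X.det.re := by
  have hu := (isUnit_iff_isUnit_det _).mp hX.isUnit
  have hdet : (X + K).det = (1 + K * X⁻¹).det * X.det := by
    rw [← det_mul, Matrix.add_mul, one_mul, Matrix.mul_assoc, nonsing_inv_mul _ hu, mul_one]
  have hre : (X + K).det.re = (1 + K * X⁻¹).det.re * X.det.re := by
    rw [hdet, Complex.mul_re, ← (Complex.pos_iff.mp hX.det_pos).2]
    simp
  have hpos := (hX.add_posSemidef hK).det_re_pos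
  rw [hre] at hpos ⊢
  rw [Real.log_mul (left_ne_zero_of_mul hpos.ne') (right_ne_zero_of_mul hpos.ne'),
    add_sub_cancel_right]

end Matrix

/-- For a positive semidefinite `K`, the function `X ↦ log det (I + K X⁻¹)` is convex
on the cone of positive definite complex matrices. -/
theorem logDet_one_add_mul_inv_convexOn
    (n : ℕ) (K : Matrix (Fin n) (Fin n) ℂ) (hK : K.PosSemidef)
    (X Y : Matrix (Fin n) (Fin n) ℂ) (hX : X.PosDef) (hY : Y.PosDef)
    (lam : ℝ) (hlam0 : 0 ≤ lam) (hlam1 : lam ≤ 1) :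
    Real.log ((1 + K * ((lam : ℂ) • X + ((1 - lam : ℝ) : ℂ) • Y)⁻¹).det.re) ≤
      lam * Real.log ((1 + K * X⁻¹).det.re)
        + (1 - lam) * Real.log ((1 + K * Y⁻¹).det.re) := by
  have hb : 0 ≤ 1 - lam := sub_nonneg.mpr hlam1
  have hab : lam + (1 - lam) = 1 := add_sub_cancel lam 1
  rw [(hX.smul_add_smul hY hlam0 hb hab).log_det_one_add_mul_inv hK,
    hX.log_det_one_add_mul_inv hK, hY.log_det_one_add_mul_inv hK]
  exact hX.log_det_add_sub_le hY hK hlam0 hb hab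
end

section
/- Let K be an n×n complex positive semidefinite matrix. Then the function g(X) = log det(K + X⁻¹) is strictly convex on the cone of n×n complex positive definite matrices; that is, for all positive definite X ≠ Y and all λ ∈ (0,1), one has g(λX + (1−λ)Y) < λ g(X) + (1−λ) g(Y). -/
open Matrix
open scoped ComplexOrder

namespace Matrix

open scoped MatrixOrder Matrix.Norms.L2Operator

variable {ι 𝕜 : Type*} [Fintype ι] [DecidableEq ι] [RCLike 𝕜]

theorem PosDef.re_det_pos {A : Matrix ι ι 𝕜} (hA : A.PosDef) : 0 < RCLike.re A.det :=
  (RCLike.pos_iff.mp hA.det_pos).1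

theorem IsHermitian.eq_one_of_eigenvalues_eq_one {H : Matrix ι ι 𝕜} (hH : H.IsHermitian)
    (h : ∀ i, hH.eigenvalues i = 1) : H = 1 := by
  have hdiag : diagonal (RCLike.ofReal ∘ hH.eigenvalues) = (1 : Matrix ι ι 𝕜) := by
    rw [← diagonal_one]
    congr 1
    ext i
    simp [h i]
  rw [hH.spectral_theorem, hdiag, map_one]

theorem PosDef.log_det_lt_trace_sub_card {H : Matrix ι ι 𝕜} (hH : H.PosDef) (hne : H ≠ 1) :
    Real.log (RCLike.re H.det) < RCLike.re H.trace - Fintype.card ι := by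
  obtain ⟨j, hj⟩ : ∃ j, hH.1.eigenvalues j ≠ 1 := by
    by_contra! h
    exact hne (hH.1.eq_one_of_eigenvalues_eq_one h)
  have hdet : RCLike.re H.det = ∏ i, hH.1.eigenvalues i := by
    rw [hH.1.det_eq_prod_eigenvalues, ← RCLike.ofReal_prod, RCLike.ofReal_re]
  have htr : RCLike.re H.trace = ∑ i, hH.1.eigenvalues i := by
    rw [hH.1.trace_eq_sum_eigenvalues, ← RCLike.ofReal_sum, RCLike.ofReal_re]
  have hcard : ∑ i, hH.1.eigenvalues i - Fintype.card ι = ∑ i, (hH.1.eigenvalues i - 1) := by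
    simp
  rw [hdet, htr, hcard, Real.log_prod fun i _ => (hH.eigenvalues_pos i).ne']
  exact Finset.sum_lt_sum (fun i _ => Real.log_le_sub_one_of_pos (hH.eigenvalues_pos i))
    ⟨j, Finset.mem_univ j, Real.log_lt_sub_one_of_pos (hH.eigenvalues_pos j) hj⟩

theorem PosDef.log_det_sub_lt {A B : Matrix ι ι 𝕜} (hA : A.PosDef) (hB : B.PosDef)
    (hne : A ≠ B) :
    Real.log (RCLike.re A.det) - Real.log (RCLike.re B.det) <
      RCLike.re (A * B⁻¹).trace - Fintype.card ι := by
  obtain ⟨S, hS⟩ := CStarAlgebra.nonneg_iff_eq_star_mul_self.mp hB.inv.posSemidef.nonneg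
  rw [star_eq_conjTranspose] at hS
  have hBdet : IsUnit B.det := (isUnit_iff_isUnit_det B).mp hB.isUnit
  have hleft : B * Sᴴ * S = 1 := by rw [mul_assoc, ← hS, mul_nonsing_inv _ hBdet]
  have hright : S * (B * Sᴴ) = 1 := mul_eq_one_comm.mp hleft
  have hSunit : IsUnit S := (isUnit_iff_exists.mpr ⟨B * Sᴴ, hright, hleft⟩)
  have hH : (S * A * Sᴴ).PosDef := by
    rw [← star_eq_conjTranspose]
    exact hSunit.posDef_star_right_conjugate_iff.mpr hA
  have hH1 : S * A * Sᴴ ≠ 1 := by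
    intro h
    apply hne
    have h' : A * Sᴴ * S = 1 := mul_eq_one_comm.mp (by rw [← mul_assoc, h])
    rw [mul_assoc, ← hS] at h'
    calc A = A * B⁻¹ * B := by rw [mul_assoc, nonsing_inv_mul _ hBdet, mul_one]
      _ = B := by rw [h', one_mul]
  have htr : (S * A * Sᴴ).trace = (A * B⁻¹).trace := by
    rw [hS, mul_assoc, trace_mul_comm, mul_assoc]
  have hdet : (S * A * Sᴴ).det * B.det = A.det := by
    calc (S * A * Sᴴ).det * B.det = A.det * (B * Sᴴ * S).det := by simp only [det_mul]; ring
      _ = A.det := by rw [hleft, det_one, mul_one]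
  have hre : RCLike.re (S * A * Sᴴ).det * RCLike.re B.det = RCLike.re A.det := by
    rw [← hdet, RCLike.mul_re, (RCLike.pos_iff.mp hB.det_pos).2, mul_zero, sub_zero]
  have key := hH.log_det_lt_trace_sub_card hH1
  rw [htr] at key
  rw [← hre, Real.log_mul hH.re_det_pos.ne' hB.re_det_pos.ne', add_sub_cancel_right]
  exact key

theorem PosDef.log_det_sub_le {A B : Matrix ι ι 𝕜} (hA : A.PosDef) (hB : B.PosDef) :
    Real.log (RCLike.re A.det) - Real.log (RCLike.re B.det) ≤
      RCLike.re (A * B⁻¹).trace - Fintype.card ι := by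
  rcases eq_or_ne A B with rfl | hne
  · simp [mul_nonsing_inv _ ((isUnit_iff_isUnit_det A).mp hA.isUnit)]
  · exact (hA.log_det_sub_lt hB hne).le

theorem PosSemidef.trace_mul_nonneg {A B : Matrix ι ι 𝕜} (hA : A.PosSemidef)
    (hB : B.PosSemidef) : 0 ≤ (A * B).trace := by
  obtain ⟨S, rfl⟩ := CStarAlgebra.nonneg_iff_eq_star_mul_self.mp hA.nonneg
  rw [star_eq_conjTranspose, mul_assoc, trace_mul_comm]
  exact (hB.mul_mul_conjTranspose_same S).trace_nonneg

/-- `(K + X⁻¹)⁻¹` is a lower bound of the affine functions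
`X ↦ Wᴴ K W + (1 - K W)ᴴ X (1 - K W)`. -/
theorem PosSemidef.posSemidef_sub_inv_add_inv {K X : Matrix ι ι 𝕜} (hK : K.PosSemidef)
    (hX : X.PosDef) (W : Matrix ι ι 𝕜) :
    (Wᴴ * K * W + (1 - K * W)ᴴ * X * (1 - K * W) - (K + X⁻¹)⁻¹).PosSemidef := by
  have hM : (K + X⁻¹).PosDef := hX.inv.posSemidef_add hK
  have hMdet : IsUnit (K + X⁻¹).det := (isUnit_iff_isUnit_det _).mp hM.isUnit
  have hXdet : IsUnit X.det := (isUnit_iff_isUnit_det _).mp hX.isUnit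
  obtain ⟨F, hF⟩ : ∃ F, F = (K + X⁻¹)⁻¹ := ⟨_, rfl⟩
  have hFH : Fᴴ = F := by rw [hF]; exact hM.inv.1
  have hl : X * K * F + F = X := by
    have h := congrArg (X * ·) (mul_nonsing_inv _ hMdet)
    simpa only [← hF, add_mul, mul_add, ← mul_assoc, mul_nonsing_inv _ hXdet, one_mul, mul_one]
      using h
  have hr : F * K * X + F = X := by
    simpa [hFH, hX.1.eq, hK.1.eq, mul_assoc] using congrArg (fun M => Mᴴ) hl
  have key : Wᴴ * K * W + (1 - K * W)ᴴ * X * (1 - K * W) - F =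
      (W - F)ᴴ * (K + Kᴴ * X * K) * (W - F) := by
    have h₁ : (K + K * X * K) * F = K * X := by
      calc (K + K * X * K) * F = K * (X * K * F + F) := by noncomm_ring
        _ = K * X := by rw [hl]
    have h₂ : F * (K + K * X * K) = X * K := by
      calc F * (K + K * X * K) = (F * K * X + F) * K := by noncomm_ring
        _ = X * K := by rw [hr]
    have h₃ : X * K * F = X - F := eq_sub_of_add_eq hl
    simp only [conjTranspose_sub, conjTranspose_one, conjTranspose_mul, hFH, hK.1.eq]
    calc _ = Wᴴ * (K + K * X * K) * W - Wᴴ * (K * X) - X * K * W + (X - F) := by noncomm_ring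
      _ = Wᴴ * (K + K * X * K) * W - Wᴴ * ((K + K * X * K) * F)
          - F * (K + K * X * K) * W + F * (K + K * X * K) * F := by rw [h₁, h₂, h₃]
      _ = _ := by noncomm_ring
  rw [← hF, key]
  exact (hK.add (hX.posSemidef.conjTranspose_mul_mul_same K)).conjTranspose_mul_mul_same _

/-- Operator concavity of `X ↦ (K + X⁻¹)⁻¹`. -/
theorem PosSemidef.posSemidef_inv_add_inv_sub {K X Y : Matrix ι ι 𝕜} (hK : K.PosSemidef)
    (hX : X.PosDef) (hY : Y.PosDef) {a b : 𝕜} (ha : 0 < a) (hb : 0 < b) (hab : a + b = 1) :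
    ((K + (a • X + b • Y)⁻¹)⁻¹ - (a • (K + X⁻¹)⁻¹ + b • (K + Y⁻¹)⁻¹)).PosSemidef := by
  have hZ : (a • X + b • Y).PosDef := (hX.smul ha).add (hY.smul hb)
  obtain ⟨Z, hZdef⟩ : ∃ Z, Z = a • X + b • Y := ⟨_, rfl⟩
  rw [← hZdef] at hZ ⊢
  have hM : (K + Z⁻¹).PosDef := hZ.inv.posSemidef_add hK
  have hMdet : IsUnit (K + Z⁻¹).det := (isUnit_iff_isUnit_det _).mp hM.isUnit
  have hZdet : IsUnit Z.det := (isUnit_iff_isUnit_det _).mp hZ.isUnit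
  obtain ⟨W, hW⟩ : ∃ W, W = (K + Z⁻¹)⁻¹ := ⟨_, rfl⟩
  have hWH : Wᴴ = W := by rw [hW]; exact hM.inv.1
  have hMW : (K + Z⁻¹) * W = 1 := by rw [hW, mul_nonsing_inv _ hMdet]
  have hKW : 1 - K * W = Z⁻¹ * W := by rw [← hMW]; noncomm_ring
  have hval : Wᴴ * K * W + (1 - K * W)ᴴ * Z * (1 - K * W) = W := by
    rw [hKW, conjTranspose_mul, hZ.inv.1.eq, hWH]
    calc _ = W * K * W + W * (Z⁻¹ * Z) * Z⁻¹ * W := by noncomm_ring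
      _ = W * ((K + Z⁻¹) * W) := by rw [nonsing_inv_mul _ hZdet]; noncomm_ring
      _ = W := by rw [hMW, mul_one]
  have hsum := ((hK.posSemidef_sub_inv_add_inv hX W).smul ha.le).add
    ((hK.posSemidef_sub_inv_add_inv hY W).smul hb.le)
  rw [← hW]
  convert! hsum using 1
  conv_lhs => rw [← hval, hZdef]
  obtain rfl : b = 1 - a := eq_sub_of_add_eq' hab
  simp only [mul_add, add_mul, mul_smul_comm, smul_mul_assoc]
  module

end Matrix

/-- For a positive semidefinite `K`, the function `X ↦ log det (K + X⁻¹)` is strictly convex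
on the cone of positive definite complex matrices. -/
theorem logDet_add_inv_strictConvexOn
    (n : ℕ) (K : Matrix (Fin n) (Fin n) ℂ) (hK : K.PosSemidef)
    (X Y : Matrix (Fin n) (Fin n) ℂ) (hX : X.PosDef) (hY : Y.PosDef) (hXY : X ≠ Y)
    (lam : ℝ) (hlam0 : 0 < lam) (hlam1 : lam < 1) :
    Real.log ((K + ((lam : ℂ) • X + ((1 - lam : ℝ) : ℂ) • Y)⁻¹).det.re) <
      lam * Real.log ((K + X⁻¹).det.re)
        + (1 - lam) * Real.log ((K + Y⁻¹).det.re) := by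
  have ha : (0 : ℂ) < lam := by exact_mod_cast hlam0
  have hb : (0 : ℂ) < ((1 - lam : ℝ) : ℂ) := by exact_mod_cast sub_pos.mpr hlam1
  have hconc := hK.posSemidef_inv_add_inv_sub hX hY ha hb (by push_cast; ring)
  have hZ : ((lam : ℂ) • X + ((1 - lam : ℝ) : ℂ) • Y).PosDef := (hX.smul ha).add (hY.smul hb)
  have hZX : (lam : ℂ) • X + ((1 - lam : ℝ) : ℂ) • Y ≠ X := by
    intro h
    have h0 : ((1 - lam : ℝ) : ℂ) • (X - Y) = 0 := by
      rw [← sub_eq_zero] at h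
      rw [← neg_eq_zero, ← h]
      push_cast
      module
    exact hXY (sub_eq_zero.mp ((smul_eq_zero.mp h0).resolve_left hb.ne'))
  generalize (lam : ℂ) • X + ((1 - lam : ℝ) : ℂ) • Y = Z at *
  have hMZ : (K + Z⁻¹).PosDef := hZ.inv.posSemidef_add hK
  have hMX : (K + X⁻¹).PosDef := hX.inv.posSemidef_add hK
  have hMY : (K + Y⁻¹).PosDef := hY.inv.posSemidef_add hK
  have hne : K + Z⁻¹ ≠ K + X⁻¹ := fun h =>
    hZX (inv_inj (add_left_cancel h) ((isUnit_iff_isUnit_det _).mp hZ.isUnit))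
  have hltX := hMZ.log_det_sub_lt hMX hne
  have hleY := hMZ.log_det_sub_le hMY
  have htr := (Complex.nonneg_iff.mp (hMZ.posSemidef.trace_mul_nonneg hconc)).1
  rw [mul_sub, mul_add, mul_nonsing_inv _ ((isUnit_iff_isUnit_det _).mp hMZ.isUnit), mul_smul_comm,
    mul_smul_comm, trace_sub, trace_add, trace_smul, trace_smul, trace_one, smul_eq_mul,
    smul_eq_mul, Complex.sub_re, Complex.add_re, Complex.re_ofReal_mul, Complex.re_ofReal_mul,
    Fintype.card_fin, Complex.natCast_re] at htr
  simp only [Fintype.card_fin, RCLike.re_to_complex] at hltX hleY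
  have hX' := mul_lt_mul_of_pos_left hltX hlam0
  have hY' := mul_le_mul_of_nonneg_left hleY (sub_pos.mpr hlam1).le
  linarith
end

section
/- The function X ↦ log det(X⁻¹) = −log det(X) is strictly convex on the cone of n×n complex positive definite matrices; that is, for all positive definite X ≠ Y and all λ ∈ (0,1), one has −log det(λX + (1−λ)Y) < −λ log det(X) − (1−λ) log det(Y). -/
open Matrix
open scoped ComplexOrder

namespace Matrix

/-- Two positive definite matrices are simultaneously congruent to the identity and to a diagonal
matrix with positive entries. -/
theorem PosDef.exists_congr_one_diagonal {ι 𝕜 : Type*} [Fintype ι] [DecidableEq ι] [RCLike 𝕜]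
    {X Y : Matrix ι ι 𝕜} (hX : X.PosDef) (hY : Y.PosDef) :
    ∃ (P : Matrix ι ι 𝕜) (d : ι → ℝ), IsUnit P ∧ (∀ i, 0 < d i) ∧
      X = star P * P ∧ Y = star P * diagonal (fun i => (d i : 𝕜)) * P := by
  open scoped MatrixOrder in
  obtain ⟨C, rfl⟩ := CStarAlgebra.nonneg_iff_eq_star_mul_self.mp hX.posSemidef.nonneg
  have hC : IsUnit C := by
    have h := hX.isUnit
    rw [isUnit_iff_isUnit_det, det_mul] at h
    exact (isUnit_iff_isUnit_det C).2 (isUnit_of_mul_isUnit_right h)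
  lift C to (Matrix ι ι 𝕜)ˣ using hC
  have hZ : (star (↑C⁻¹ : Matrix ι ι 𝕜) * Y * (↑C⁻¹ : Matrix ι ι 𝕜)).PosDef :=
    (IsUnit.posDef_star_left_conjugate_iff C⁻¹.isUnit).2 hY
  set U := hZ.isHermitian.eigenvectorUnitary with hU
  have hUU : (U : Matrix ι ι 𝕜) * star (U : Matrix ι ι 𝕜) = 1 := Unitary.coe_mul_star_self U
  refine ⟨star (U : Matrix ι ι 𝕜) * C, hZ.isHermitian.eigenvalues, ?_, hZ.eigenvalues_pos, ?_, ?_⟩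
  · exact (IsUnit.of_mul_eq_one _ hUU).star.mul C.isUnit
  · rw [star_mul, star_star, mul_assoc, ← mul_assoc (U : Matrix ι ι 𝕜), hUU, one_mul]
  · have hspec := hZ.isHermitian.spectral_theorem
    rw [Unitary.conjStarAlgAut_apply, ← hU] at hspec
    calc Y = star (C : Matrix ι ι 𝕜) * (star (↑C⁻¹ : Matrix ι ι 𝕜) * Y * (↑C⁻¹ : Matrix ι ι 𝕜)) * C := by
          simp only [mul_assoc, Units.inv_mul, mul_one]
          rw [← mul_assoc, ← star_mul, Units.inv_mul, star_one, one_mul]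
      _ = _ := by
          refine (congrArg (fun A => star (C : Matrix ι ι 𝕜) * A * C) hspec).trans ?_
          simp only [star_mul, star_star, mul_assoc, Function.comp_def]

theorem det_star_mul_diagonal_mul {ι : Type*} [Fintype ι] [DecidableEq ι]
    (P : Matrix ι ι ℂ) (c : ι → ℝ) :
    (star P * diagonal (fun i => (c i : ℂ)) * P).det
      = ((Complex.normSq P.det * ∏ i, c i : ℝ) : ℂ) := by
  rw [det_mul, det_mul, det_diagonal, star_eq_conjTranspose, det_conjTranspose]
  push_cast
  rw [Complex.normSq_eq_conj_mul_self, Complex.star_def]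
  ring

theorem log_det_re_star_mul_diagonal_mul {ι : Type*} [Fintype ι] [DecidableEq ι]
    {P : Matrix ι ι ℂ} (hP : IsUnit P) {c : ι → ℝ} (hc : ∀ i, 0 < c i) :
    Real.log (star P * diagonal (fun i => (c i : ℂ)) * P).det.re
      = Real.log (Complex.normSq P.det) + ∑ i, Real.log (c i) := by
  have hdet : P.det ≠ 0 := ((isUnit_iff_isUnit_det P).1 hP).ne_zero
  rw [det_star_mul_diagonal_mul, Complex.ofReal_re,
    Real.log_mul (Complex.normSq_pos.2 hdet).ne' (Finset.prod_ne_zero_iff.2 fun i _ => (hc i).ne'),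
    Real.log_prod fun i _ => (hc i).ne']

end Matrix

/-- The function `X ↦ -log det X` is strictly convex on the cone of positive definite
complex matrices. -/
theorem neg_logDet_strictConvexOn
    (n : ℕ) (X Y : Matrix (Fin n) (Fin n) ℂ) (hX : X.PosDef) (hY : Y.PosDef) (hXY : X ≠ Y)
    (lam : ℝ) (hlam0 : 0 < lam) (hlam1 : lam < 1) :
    -Real.log (((lam : ℂ) • X + ((1 - lam : ℝ) : ℂ) • Y).det.re) <
      -(lam * Real.log (X.det.re)) - (1 - lam) * Real.log (Y.det.re) := by
  obtain ⟨P, d, hP, hd, rfl, rfl⟩ := hX.exists_congr_one_diagonal hY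
  have hlam : 0 < 1 - lam := sub_pos.2 hlam1
  have hone : star P * P = star P * diagonal (fun _ => ((1 : ℝ) : ℂ)) * P := by simp
  have hcomb : (lam : ℂ) • (star P * P)
        + ((1 - lam : ℝ) : ℂ) • (star P * diagonal (fun i => (d i : ℂ)) * P)
      = star P * diagonal (fun i => ((lam + (1 - lam) * d i : ℝ) : ℂ)) * P := by
    have hdiag : diagonal (fun i => ((lam + (1 - lam) * d i : ℝ) : ℂ))
        = (lam : ℂ) • (1 : Matrix (Fin n) (Fin n) ℂ)
          + ((1 - lam : ℝ) : ℂ) • diagonal (fun i => (d i : ℂ)) := by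
      rw [smul_one_eq_diagonal, ← diagonal_smul, diagonal_add]
      congr 1
      ext i
      simp
    rw [hdiag, mul_add, add_mul, mul_smul_comm, mul_smul_comm, smul_mul_assoc, smul_mul_assoc,
      mul_one]
  obtain ⟨j, hj⟩ : ∃ j, 1 ≠ d j := by
    by_contra! h
    exact hXY (by simp [← h])
  have hsum : ∑ i, (1 - lam) * Real.log (d i) < ∑ i, Real.log (lam + (1 - lam) * d i) := by
    refine Finset.sum_lt_sum (fun i _ => ?_) ⟨j, Finset.mem_univ j, ?_⟩
    · simpa using strictConcaveOn_log_Ioi.concaveOn.2 (Set.mem_Ioi.2 one_pos)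
        (Set.mem_Ioi.2 (hd i)) hlam0.le hlam.le (add_sub_cancel lam 1)
    · simpa using strictConcaveOn_log_Ioi.2 (Set.mem_Ioi.2 one_pos)
        (Set.mem_Ioi.2 (hd j)) hj hlam0 hlam (add_sub_cancel lam 1)
  simp only [RCLike.ofReal_eq_complex_ofReal]
  rw [hcomb, hone, log_det_re_star_mul_diagonal_mul hP fun _ => one_pos,
    log_det_re_star_mul_diagonal_mul hP hd,
    log_det_re_star_mul_diagonal_mul hP fun i => add_pos hlam0 (mul_pos hlam (hd i))]
  rw [← Finset.mul_sum] at hsum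
  simp only [Real.log_one, Finset.sum_const_zero]
  linarith
end
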